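/- arXiv:1902.02151 — 2 statements merged into one kernel-verified Lean document; each statement's English description precedes it below -/
import Mathlib

section
/- For every ω ∈ W_0 and every a ∈ S_ω one has I = K_1 · ((ω t_a) I (ω t_a)^{-1} ∩ K), i.e. every element of I is the product of an element of K_1 and an element of (ω t_a) I (ω t_a)^{-1} ∩ K. -/
open Matrix

noncomputable section

namespace IH

variable (p : ℕ) [Fact p.Prime]

/-- `\bar{𝔽}_p`, an algebraic closure of the residue field. -/
abbrev kb := AlgebraicClosure (ZMod p)

variable (N : ℕ)

/-- `G = GL_N(F)` with `F = ℚ_p`. -/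
abbrev GG := GL (Fin N) ℚ_[p]
/-- `GL_N(O_F)` (as an abstract group, mapping onto `K ⊆ G`). -/
abbrev MM := GL (Fin N) ℤ_[p]
/-- `GL_N(k_F)`. -/
abbrev Gk := GL (Fin N) (ZMod p)

/-- The inclusion `GL_N(O_F) → GL_N(F)`. -/
def iotaM : MM p N →* GG p N := Matrix.GeneralLinearGroup.map (PadicInt.Coe.ringHom)

/-- The reduction map `red : GL_N(O_F) → GL_N(k_F)`. -/
def redM : MM p N →* Gk p N := Matrix.GeneralLinearGroup.map (PadicInt.toZMod)

/-- Elements of `GL_N(O_F)` whose reduction is upper triangular: the Iwahori condition. -/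
def Ipre : Set (MM p N) :=
  {m | ∀ i j : Fin N, j < i → ((redM p N m : Matrix (Fin N) (Fin N) (ZMod p)) i j = 0)}

/-- Elements of `GL_N(O_F)` whose reduction is upper triangular unipotent: pro-p Iwahori. -/
def I1pre : Set (MM p N) :=
  {m | m ∈ Ipre p N ∧ ∀ i : Fin N, ((redM p N m : Matrix (Fin N) (Fin N) (ZMod p)) i i = 1)}

/-- Elements of `GL_N(O_F)` reducing to the identity: `K_1 = ker red`. -/
def K1pre : Set (MM p N) := {m | redM p N m = 1}

/-- `K = GL_N(O_F)` as a subset of `G`. -/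
def Kset : Set (GG p N) := Set.range (iotaM p N)
/-- The Iwahori subgroup `I ⊆ G`. -/
def Iset : Set (GG p N) := iotaM p N '' Ipre p N
/-- The pro-p Iwahori subgroup `I_1 ⊆ G`. -/
def I1set : Set (GG p N) := iotaM p N '' I1pre p N
/-- `K_1 ⊆ G`. -/
def K1set : Set (GG p N) := iotaM p N '' K1pre p N

/-- The uniformizer `ϖ = p` as a unit of `ℚ_p`. -/
def pU : ℚ_[p]ˣ :=
  Units.mk0 (p : ℚ_[p]) (by
    have h := (Fact.out : p.Prime).ne_zero
    exact_mod_cast Nat.cast_ne_zero.mpr h)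

/-- Scalar matrices as elements of `G`. -/
def scalarGL (u : ℚ_[p]ˣ) : GG p N :=
  Units.map (algebraMap ℚ_[p] (Matrix (Fin N) (Fin N) ℚ_[p])).toMonoidHom u

/-- The central element `ϖ^n · Id`. -/
def piSc (n : ℤ) : GG p N := scalarGL p N (pU p ^ n)

/-- Invertible diagonal matrices. -/
def diagGL (d : Fin N → ℚ_[p]ˣ) : GG p N where
  val := Matrix.diagonal fun i => (d i : ℚ_[p])
  inv := Matrix.diagonal fun i => (((d i)⁻¹ : ℚ_[p]ˣ) : ℚ_[p])
  val_inv := by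
    rw [Matrix.diagonal_mul_diagonal]
    simp
  inv_val := by
    rw [Matrix.diagonal_mul_diagonal]
    simp

/-- extend `a ∈ ℤ^{N-1}` by `0` in the last coordinate. -/
def expo (a : Fin (N - 1) → ℤ) : Fin N → ℤ :=
  fun i => if h : (i : ℕ) < N - 1 then a ⟨i, h⟩ else 0

/-- `t_a = diag(ϖ^{a_1}, …, ϖ^{a_{N-1}}, 1)`. -/
def tGL (a : Fin (N - 1) → ℤ) : GG p N :=
  diagGL p N fun i => pU p ^ (expo N a i)

/-- The permutation matrix of `σ` (with `permGL σ · e_j = e_{σ j}`, so that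
`permGL` is a group homomorphism). -/
def permGL (σ : Equiv.Perm (Fin N)) : GG p N where
  val := (σ⁻¹).permMatrix ℚ_[p]
  inv := σ.permMatrix ℚ_[p]
  val_inv := by
    show ((σ⁻¹).toPEquiv.toMatrix : Matrix (Fin N) (Fin N) ℚ_[p]) * σ.toPEquiv.toMatrix = 1
    rw [← PEquiv.toMatrix_trans, ← Equiv.toPEquiv_trans]
    simp only [Equiv.self_trans_symm, Equiv.symm_trans_self, Equiv.Perm.inv_def]
    rw [Equiv.toPEquiv_refl, PEquiv.toMatrix_refl]
  inv_val := by
    show (σ.toPEquiv.toMatrix : Matrix (Fin N) (Fin N) ℚ_[p]) * (σ⁻¹).toPEquiv.toMatrix = 1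
    rw [← PEquiv.toMatrix_trans, ← Equiv.toPEquiv_trans]
    simp only [Equiv.self_trans_symm, Equiv.symm_trans_self, Equiv.Perm.inv_def]
    rw [Equiv.toPEquiv_refl, PEquiv.toMatrix_refl]

/-- `ω t_a`. -/
def wS (σ : Equiv.Perm (Fin N)) (a : Fin (N - 1) → ℤ) : GG p N :=
  permGL p N σ * tGL p N a

/-- The permutation `ω₂` (as a matrix: first row block `(0, I_{N-1})`, last row `(1,0,…,0)`). -/
def w2 : Equiv.Perm (Fin N) := (finRotate N)⁻¹

/-- `γ = ω₂ · diag(ϖ, I_{N-1})`. -/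
def gammaGL : GG p N :=
  permGL p N (w2 N) * tGL p N fun i => if (i : ℕ) = 0 then 1 else 0

/-- `S_ω = {a ∈ ℤ^{N-1} : (ω t_a) I (ω t_a)⁻¹ ∩ K ⊆ I}`. -/
def Sset (σ : Equiv.Perm (Fin N)) : Set (Fin (N - 1) → ℤ) :=
  {a | ∀ g ∈ Iset p N,
    wS p N σ a * g * (wS p N σ a)⁻¹ ∈ Kset p N →
    wS p N σ a * g * (wS p N σ a)⁻¹ ∈ Iset p N}

/-- The unit of `k_F^×` attached to a nonzero element of `k_F` (junk value `1` at `0`). -/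
def unitOf (x : ZMod p) : (ZMod p)ˣ :=
  if h : x = 0 then 1 else Units.mk0 x h

/-- The diagonal of the reduction of `m`, as an `N`-tuple of units of `k_F`. -/
def diagOf (m : MM p N) : Fin N → (ZMod p)ˣ :=
  fun i => unitOf p ((redM p N m : Matrix (Fin N) (Fin N) (ZMod p)) i i)

/-- The transformation rule for functions in `H_{IZ}(χ)`, where the character `χ` of `I`
is given by the character `ξ` of the torus `(k_F^×)^N` through the diagonal of the
reduction, extended to `IZ` by `χ(ϖ) = 1`. -/
def HTransf (ξ : (Fin N → (ZMod p)ˣ) →* (kb p)ˣ) (φ : GG p N → kb p) : Prop :=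
  ∀ (n₁ n₂ : ℤ) (m₁ m₂ : MM p N), m₁ ∈ Ipre p N → m₂ ∈ Ipre p N → ∀ g : GG p N,
    φ (piSc p N n₁ * iotaM p N m₁ * g * (piSc p N n₂ * iotaM p N m₂)) =
      (ξ (diagOf p N m₁) : kb p) * (ξ (diagOf p N m₂) : kb p) * φ g

/-- `φ` is supported on the double coset `IZ x I`. -/
def SuppDouble (φ : GG p N → kb p) (x : GG p N) : Prop :=
  ∀ g : GG p N, φ g ≠ 0 → ∃ (n : ℤ) (m₁ m₂ : MM p N), m₁ ∈ Ipre p N ∧ m₂ ∈ Ipre p N ∧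
    g = piSc p N n * iotaM p N m₁ * x * iotaM p N m₂

/-- Membership in `H_{IZ}(χ)`: the transformation rule together with support in
finitely many double cosets `IZ g I`. -/
def HMem (ξ : (Fin N → (ZMod p)ˣ) →* (kb p)ˣ) (φ : GG p N → kb p) : Prop :=
  HTransf p N ξ φ ∧
  ∃ S : Finset (GG p N), ∀ g : GG p N, φ g ≠ 0 →
    ∃ s ∈ S, ∃ (n : ℤ) (m₁ m₂ : MM p N), m₁ ∈ Ipre p N ∧ m₂ ∈ Ipre p N ∧
      g = piSc p N n * iotaM p N m₁ * s * iotaM p N m₂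

section Rep

variable {V : Type} [AddCommGroup V] [Module (kb p) V]

/-- `σ` (here `ρ`) is irreducible. -/
def IsIrred (ρ : Representation (kb p) (Gk p N) V) : Prop :=
  (∃ v : V, v ≠ 0) ∧
  ∀ W : Submodule (kb p) V, (∀ g v, v ∈ W → ρ g v ∈ W) → W = ⊥ ∨ W = ⊤

/-- Membership in the compact induction `ind_{KZ}^G σ`: left `KZ`-equivariance
(where `ϖ` acts trivially), support in finitely many cosets `KZ g`, and smoothness. -/
def IndMem (ρ : Representation (kb p) (Gk p N) V) (f : GG p N → V) : Prop :=
  (∀ (n : ℤ) (m : MM p N) (g : GG p N),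
      f (piSc p N n * iotaM p N m * g) = ρ (redM p N m) (f g)) ∧
  (∃ S : Finset (GG p N), ∀ g : GG p N, f g ≠ 0 →
      ∃ s ∈ S, ∃ (n : ℤ) (m : MM p N), g = piSc p N n * iotaM p N m * s) ∧
  (∃ U : Subgroup (GG p N), IsOpen (U : Set (GG p N)) ∧ ∀ u ∈ U, ∀ g, f (g * u) = f g)

/-- `f` is invariant under right translation by `I_1`. -/
def IsI1Inv (f : GG p N → V) : Prop :=
  ∀ u ∈ I1set p N, ∀ g, f (g * u) = f g

/-- The defining property of the standard function `f_{ω,a}`: an `I_1`-invariant member of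
`ind_{KZ}^G σ` supported on `KZ t_a I_1` with value `v₀` at `ω t_a`. -/
def IsStd (ρ : Representation (kb p) (Gk p N) V) (v₀ : V)
    (σp : Equiv.Perm (Fin N)) (a : Fin (N - 1) → ℤ) (f : GG p N → V) : Prop :=
  IndMem p N ρ f ∧ IsI1Inv p N f ∧
  (∀ g : GG p N, f g ≠ 0 → ∃ (n : ℤ) (m : MM p N) (u : GG p N), u ∈ I1set p N ∧
      g = piSc p N n * iotaM p N m * tGL p N a * u) ∧
  f (wS p N σp a) = v₀

/-- `R` is a set of representatives for `I_1/(I_1 ∩ g⁻¹ I_1 g)`. -/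
def IsRepSet (g : GG p N) (R : Finset (GG p N)) : Prop :=
  (↑R ⊆ I1set p N) ∧
  ∀ x ∈ I1set p N, ∃! r : GG p N, r ∈ R ∧
    (r⁻¹ * x ∈ I1set p N ∧ g * (r⁻¹ * x) * g⁻¹ ∈ I1set p N)

/-- The Hecke operator: `f|T_g = ∑_{r} (r g⁻¹)·f`, where `(h·f)(x) = f(xh)`. -/
def hk (g : GG p N) (R : Finset (GG p N)) (f : GG p N → V) : GG p N → V :=
  fun x => ∑ r ∈ R, f (x * r * g⁻¹)

end Rep


section Aux

variable {p N}

lemma iotaM_apply (m : MM p N) (i j : Fin N) :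
    (iotaM p N m : Matrix (Fin N) (Fin N) ℚ_[p]) i j =
      (((m : Matrix (Fin N) (Fin N) ℤ_[p]) i j : ℤ_[p]) : ℚ_[p]) := rfl

lemma redM_apply (m : MM p N) (i j : Fin N) :
    (redM p N m : Matrix (Fin N) (Fin N) (ZMod p)) i j =
      PadicInt.toZMod ((m : Matrix (Fin N) (Fin N) ℤ_[p]) i j) := rfl

lemma iotaM_injective : Function.Injective (iotaM p N) := by
  intro m m' h
  ext i j
  exact Subtype.coe_injective (congrArg (fun g : GG p N => g.val i j) h)

lemma padicInt_isUnit_of_isUnit_toZMod {z : ℤ_[p]} (h : IsUnit (PadicInt.toZMod z)) :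
    IsUnit z := by
  by_contra hz
  have hm : z ∈ IsLocalRing.maximalIdeal ℤ_[p] := hz
  rw [← PadicInt.ker_toZMod, RingHom.mem_ker] at hm
  exact h.ne_zero hm

lemma wS_apply (σ : Equiv.Perm (Fin N)) (a : Fin (N - 1) → ℤ) (k l : Fin N) :
    (wS p N σ a : Matrix (Fin N) (Fin N) ℚ_[p]) k l =
      if k = σ l then (p : ℚ_[p]) ^ expo N a l else 0 := by
  have h : (wS p N σ a : Matrix (Fin N) (Fin N) ℚ_[p]) =
      (σ⁻¹).permMatrix ℚ_[p] *
        Matrix.diagonal fun i => ((pU p ^ expo N a i : ℚ_[p]ˣ) : ℚ_[p]) := rfl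
  rw [h, Matrix.mul_diagonal, Equiv.Perm.permMatrix, PEquiv.toMatrix_apply]
  simp [pU, Equiv.toPEquiv_apply, Equiv.symm_apply_eq]

/-- Entrywise description of conjugation by `ω t_a`. -/
lemma mul_wS_eq_wS_mul_iff (σ : Equiv.Perm (Fin N)) (a : Fin (N - 1) → ℤ)
    (Y X : Matrix (Fin N) (Fin N) ℚ_[p]) :
    Y * (wS p N σ a).val = (wS p N σ a).val * X ↔
      ∀ i j, Y (σ i) (σ j) * (p : ℚ_[p]) ^ expo N a j = (p : ℚ_[p]) ^ expo N a i * X i j := by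
  have hl : ∀ k j, (Y * (wS p N σ a).val) k j = Y k (σ j) * (p : ℚ_[p]) ^ expo N a j := by
    intro k j
    simp [Matrix.mul_apply, wS_apply]
  have hr : ∀ i j, ((wS p N σ a).val * X) (σ i) j = (p : ℚ_[p]) ^ expo N a i * X i j := by
    intro i j
    simp [Matrix.mul_apply, wS_apply]
  constructor
  · intro h i j
    rw [← hl, ← hr, h]
  · intro h
    ext k j
    obtain ⟨i, rfl⟩ := σ.surjective k
    rw [hl, hr, h]

lemma zpow_toNat_sub (e f : ℤ) (h : e ≤ f) :
    (p : ℚ_[p]) ^ f = (p : ℚ_[p]) ^ e * (p : ℚ_[p]) ^ (f - e).toNat := by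
  have hp : (p : ℚ_[p]) ≠ 0 := by exact_mod_cast (Fact.out : p.Prime).ne_zero
  rw [← zpow_natCast, ← zpow_add₀ hp, Int.toNat_of_nonneg (by lia)]
  congr 1
  ring

/-- Elementary matrices in `GL_N(O_F)`. -/
def elemM {i j : Fin N} (h : i ≠ j) (c : ℤ_[p]) : MM p N :=
  Matrix.GeneralLinearGroup.mk'' (Matrix.transvection i j c)
    (by rw [Matrix.det_transvection_of_ne i j h]; exact isUnit_one)

lemma elemM_apply {i j : Fin N} (h : i ≠ j) (c : ℤ_[p]) (k l : Fin N) :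
    (elemM h c : Matrix (Fin N) (Fin N) ℤ_[p]) k l =
      (if k = l then 1 else 0) + if i = k ∧ j = l then c else 0 := by
  show Matrix.transvection i j c k l = _
  rw [Matrix.transvection, Matrix.add_apply, Matrix.one_apply, Matrix.single_apply]

/-- Membership in `S_ω` forces the lower triangular entries of `(ω t_a) I (ω t_a)⁻¹` to be
divisible by the uniformizer. -/
lemma expo_le_of_mem_Sset {σ : Equiv.Perm (Fin N)} {a : Fin (N - 1) → ℤ} (ha : a ∈ Sset p N σ)
    {i j : Fin N} (hij : σ j < σ i) :
    1 ≤ expo N a i - expo N a j + if j < i then 1 else 0 := by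
  by_contra! hlt
  have hne : i ≠ j := fun h => by simp [h] at hij
  have hle : expo N a i ≤ expo N a j := by split_ifs at hlt <;> lia
  set c := (expo N a j - expo N a i).toNat with hc
  set m : MM p N := elemM hne ((p : ℤ_[p]) ^ c) with hm
  set u : MM p N := elemM (σ.injective.ne hne) 1 with hu
  have hmI : m ∈ Ipre p N := by
    intro k l hlk
    rw [redM_apply, hm, elemM_apply, if_neg hlk.ne']
    split_ifs with h
    · obtain ⟨rfl, rfl⟩ := h
      rw [if_pos hlk] at hlt
      have hc0 : c ≠ 0 := by lia
      simp [hc0]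
    · simp
  have hconj : wS p N σ a * iotaM p N m * (wS p N σ a)⁻¹ = iotaM p N u := by
    symm
    rw [eq_mul_inv_iff_mul_eq]
    apply Units.ext
    refine (mul_wS_eq_wS_mul_iff σ a _ _).2 fun k l => ?_
    rw [iotaM_apply, iotaM_apply, hm, hu, elemM_apply, elemM_apply]
    simp only [σ.injective.eq_iff]
    by_cases hkl : k = l
    · subst hkl
      have h1 : ¬ (i = k ∧ j = k) := fun h => hne (h.1.trans h.2.symm)
      simp [h1]
    · by_cases h : i = k ∧ j = l
      · obtain ⟨rfl, rfl⟩ := h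
        simpa [hkl] using zpow_toNat_sub _ _ hle
      · simp [hkl, h]
  have hmem := ha (iotaM p N m) ⟨m, hmI, rfl⟩ (by rw [hconj]; exact ⟨u, rfl⟩)
  rw [hconj] at hmem
  obtain ⟨u', hu', he⟩ := hmem
  rw [iotaM_injective he] at hu'
  have h0 := hu' (σ i) (σ j) hij
  rw [redM_apply, hu, elemM_apply] at h0
  simp [hne] at h0

/-- Modulo `K_1`, every element of the Iwahori subgroup is upper triangular. -/
lemma exists_upperTriangular_redM_eq {m : MM p N} (hm : m ∈ Ipre p N) :
    ∃ u : MM p N, redM p N u = redM p N m ∧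
      ∀ i j : Fin N, j < i → (u : Matrix (Fin N) (Fin N) ℤ_[p]) i j = 0 := by
  let U : Matrix (Fin N) (Fin N) ℤ_[p] := Matrix.of fun i j => if j < i then 0 else m.val i j
  have hU : PadicInt.toZMod.mapMatrix U = (redM p N m).val := by
    ext i j
    rw [RingHom.mapMatrix_apply, Matrix.map_apply]
    by_cases h : j < i
    · rw [hm i j h]
      simp [U, h]
    · simp [U, h, redM_apply]
  have hdet : IsUnit U.det := by
    apply padicInt_isUnit_of_isUnit_toZMod
    rw [RingHom.map_det, hU]
    exact (Matrix.isUnit_iff_isUnit_det _).1 (redM p N m).isUnit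
  refine ⟨Matrix.GeneralLinearGroup.mk'' U hdet, Units.ext hU, fun i j h => ?_⟩
  show U i j = 0
  simp [U, h]

/-- Upper triangular elements of `GL_N(O_F)` lie in `(ω t_a) I (ω t_a)⁻¹` for `a ∈ S_ω`. -/
lemma exists_Iset_conj_eq {σ : Equiv.Perm (Fin N)} {a : Fin (N - 1) → ℤ} (ha : a ∈ Sset p N σ)
    {u : MM p N} (hu : ∀ i j : Fin N, j < i → (u : Matrix (Fin N) (Fin N) ℤ_[p]) i j = 0) :
    ∃ g ∈ Iset p N, iotaM p N u = wS p N σ a * g * (wS p N σ a)⁻¹ := by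
  let X : Matrix (Fin N) (Fin N) ℤ_[p] :=
    Matrix.of fun i j => (p : ℤ_[p]) ^ (expo N a j - expo N a i).toNat * u.val (σ i) (σ j)
  have hX : (iotaM p N u).val * (wS p N σ a).val =
      (wS p N σ a).val * PadicInt.Coe.ringHom.mapMatrix X := by
    rw [mul_wS_eq_wS_mul_iff]
    intro i j
    have hXij : PadicInt.Coe.ringHom.mapMatrix X i j =
        (p : ℚ_[p]) ^ (expo N a j - expo N a i).toNat * ((u.val (σ i) (σ j) : ℤ_[p]) : ℚ_[p]) := by
      show ((((p : ℤ_[p]) ^ (expo N a j - expo N a i).toNat * u.val (σ i) (σ j) : ℤ_[p])) :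
        ℚ_[p]) = _
      push_cast
      rfl
    rw [iotaM_apply, hXij]
    rcases lt_trichotomy (σ i) (σ j) with h | h | h
    · have hle : expo N a i ≤ expo N a j := by
        have := expo_le_of_mem_Sset ha h
        split_ifs at this <;> lia
      rw [zpow_toNat_sub _ _ hle]
      ring
    · obtain rfl := σ.injective h
      simp [mul_comm]
    · simp [hu _ _ h]
  have hdet : X.det = u.val.det := by
    have h := congrArg Matrix.det hX
    rw [Matrix.det_mul, Matrix.det_mul, mul_comm] at h
    have hw : (wS p N σ a).val.det ≠ 0 :=
      ((Matrix.isUnit_iff_isUnit_det _).1 (wS p N σ a).isUnit).ne_zero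
    have h' := mul_left_cancel₀ hw h
    have hi : (iotaM p N u).val = PadicInt.Coe.ringHom.mapMatrix u.val := rfl
    rw [hi, ← RingHom.map_det, ← RingHom.map_det] at h'
    exact (Subtype.coe_injective h').symm
  have hdetX : IsUnit X.det := by
    rw [hdet]
    exact (Matrix.isUnit_iff_isUnit_det _).1 u.isUnit
  refine ⟨iotaM p N (Matrix.GeneralLinearGroup.mk'' X hdetX), ⟨_, fun i j hji => ?_, rfl⟩, ?_⟩
  · rw [redM_apply]
    show PadicInt.toZMod (X i j) = 0
    rcases lt_trichotomy (σ i) (σ j) with h | h | h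
    · have hlt := expo_le_of_mem_Sset ha h
      rw [if_neg hji.not_gt] at hlt
      have h0 : (expo N a j - expo N a i).toNat ≠ 0 := by lia
      simp [X, h0]
    · exact absurd (σ.injective h) hji.ne'
    · simp [X, hu _ _ h]
  · rw [eq_mul_inv_iff_mul_eq]
    exact Units.ext hX

end Aux

/-- for `a ∈ S_ω`, `I = K_1 · ((ω t_a) I (ω t_a)⁻¹ ∩ K)`. -/
theorem stmt2 (p : ℕ) [Fact p.Prime] (n : ℕ)
    (ω : Equiv.Perm (Fin (n + 3))) (a : Fin (n + 2) → ℤ) (ha : a ∈ Sset p (n + 3) ω) :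
    ∀ x ∈ Iset p (n + 3), ∃ k ∈ K1set p (n + 3), ∃ y : GG p (n + 3),
      (y ∈ Kset p (n + 3) ∧
        ∃ g ∈ Iset p (n + 3), y = wS p (n + 3) ω a * g * (wS p (n + 3) ω a)⁻¹) ∧
      x = k * y := by
  rintro _ ⟨m, hm, rfl⟩
  obtain ⟨u, hred, hu⟩ := exists_upperTriangular_redM_eq hm
  refine ⟨iotaM p (n + 3) (m * u⁻¹), ⟨_, ?_, rfl⟩, iotaM p (n + 3) u,
    ⟨⟨u, rfl⟩, exists_Iset_conj_eq ha hu⟩, ?_⟩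
  · show redM p (n + 3) (m * u⁻¹) = 1
    rw [map_mul, map_inv, hred, mul_inv_cancel]
  · rw [← map_mul, inv_mul_cancel_right]

end IH
end
end

section
/- For every ω ∈ W_0 the set S_ω is nonempty. -/
open Matrix

noncomputable section

namespace IH

variable (p : ℕ) [Fact p.Prime]

variable (N : ℕ)

/-- Left multiplication by `ω t_a` permutes and rescales the rows. -/
lemma wS_mul_apply {p : ℕ} [Fact p.Prime] {N : ℕ} (σ : Equiv.Perm (Fin N)) (a : Fin (N - 1) → ℤ)
    (g : GG p N) (i k : Fin N) :
    (wS p N σ a * g).val i k = (p : ℚ_[p]) ^ expo N a (σ.symm i) * g.val (σ.symm i) k := by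
  have h : (wS p N σ a * g).val = σ.symm.toPEquiv.toMatrix *
      (Matrix.diagonal (fun i => (p : ℚ_[p]) ^ expo N a i) * g.val) := by
    rw [← Matrix.mul_assoc]
    simp [wS, Equiv.Perm.inv_def, permGL, tGL, diagGL, pU, Equiv.Perm.permMatrix]
  rw [h, PEquiv.toMatrix_toPEquiv_mul, Matrix.submatrix_apply, Matrix.diagonal_mul, id]

/-- Right multiplication by `ω t_a` permutes and rescales the columns. -/
lemma mul_wS_apply {p : ℕ} [Fact p.Prime] {N : ℕ} (σ : Equiv.Perm (Fin N)) (a : Fin (N - 1) → ℤ)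
    (g : GG p N) (i k : Fin N) :
    (g * wS p N σ a).val i k = g.val i (σ k) * (p : ℚ_[p]) ^ expo N a k := by
  have h : (g * wS p N σ a).val = g.val * σ.symm.toPEquiv.toMatrix *
      Matrix.diagonal (fun i => (p : ℚ_[p]) ^ expo N a i) := by
    rw [Matrix.mul_assoc]
    simp [wS, Equiv.Perm.inv_def, permGL, tGL, diagGL, pU, Equiv.Perm.permMatrix]
  rw [h, Matrix.mul_diagonal, PEquiv.mul_toMatrix_toPEquiv, Matrix.submatrix_apply]
  rfl

/-- If the exponents of `t_a` are strictly increasing along `ω⁻¹`, then `a ∈ S_ω`. -/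
lemma mem_Sset_of_strictMono {p : ℕ} [Fact p.Prime] {N : ℕ} (σ : Equiv.Perm (Fin N))
    (a : Fin (N - 1) → ℤ) (ha : StrictMono fun i => expo N a (σ.symm i)) :
    a ∈ Sset p N σ := by
  rintro _ ⟨m₀, -, rfl⟩ ⟨m, hm⟩
  refine ⟨m, fun i j hij => ?_, hm⟩
  have hp : (p : ℚ_[p]) ≠ 0 := Nat.cast_ne_zero.mpr (Fact.out : p.Prime).ne_zero
  have hmul : iotaM p N m * wS p N σ a = wS p N σ a * iotaM p N m₀ := by
    rw [hm, inv_mul_cancel_right]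
  have hentry : (m.val i j : ℚ_[p]) * (p : ℚ_[p]) ^ expo N a (σ.symm j) =
      (p : ℚ_[p]) ^ expo N a (σ.symm i) * (m₀.val (σ.symm i) (σ.symm j) : ℚ_[p]) := by
    have h := mul_wS_apply σ a (iotaM p N m) i (σ.symm j)
    rw [hmul, wS_mul_apply, Equiv.apply_symm_apply] at h
    exact h.symm
  obtain ⟨k, hk⟩ := Int.le.dest (ha hij)
  have hdvd : m.val i j = (p : ℤ_[p]) * ((p : ℤ_[p]) ^ k * m₀.val (σ.symm i) (σ.symm j)) := by
    apply Subtype.coe_injective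
    beta_reduce
    have hk' : expo N a (σ.symm i) = expo N a (σ.symm j) + 1 + k := hk.symm
    rw [hk', zpow_add₀ hp, zpow_add₀ hp, zpow_one, zpow_natCast] at hentry
    apply mul_right_cancel₀ (zpow_ne_zero (expo N a (σ.symm j)) hp)
    refine hentry.trans ?_
    push_cast
    ring
  change PadicInt.toZMod (m.val i j) = 0
  rw [hdvd, map_mul, map_natCast, CharP.cast_eq_zero, zero_mul]

/-- every `S_ω` is nonempty. -/
theorem stmt6 (p : ℕ) [Fact p.Prime] (n : ℕ) (ω : Equiv.Perm (Fin (n + 3))) :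
    (Sset p (n + 3) ω).Nonempty := by
  refine ⟨fun k => (ω ⟨k, by omega⟩ : ℤ) - (ω (Fin.last _) : ℤ), mem_Sset_of_strictMono _ _ ?_⟩
  have hexpo (i : Fin (n + 3)) : expo (n + 3) (fun k => (ω ⟨k, by omega⟩ : ℤ) -
      (ω (Fin.last _) : ℤ)) i = (ω i : ℤ) - (ω (Fin.last _) : ℤ) := by
    unfold expo
    split_ifs with h
    · rfl
    · rw [show i = Fin.last _ from Fin.ext (by simp; omega), sub_self]
  intro i j hij
  simp only [hexpo, Equiv.apply_symm_apply]
  have : (i : ℕ) < j := hij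
  omega

end IH
end
end
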